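/- With H, K, Γ, 𝔅, ℭ, A as above (Γ a concrete C*-module with [ΓH]=K, A nondegenerate with [A𝔅] ⊆ A), one has Ind_Γ(A) = {T ∈ Ind_Γ(L(H)) : Γ*TΓ ⊆ A}, where Ind_Γ(L(H)) = {T ∈ L(K) : TΓ ⊆ [ΓL(H)], T*Γ ⊆ [ΓL(H)]}. -/

import Mathlib

noncomputable section
open ContinuousLinearMap

/-- Closed linear span of a subset of a complex normed space. -/
def clspan {E : Type*} [NormedAddCommGroup E] [NormedSpace ℂ E] (S : Set E) : Set E :=
  ((Submodule.span ℂ S).topologicalClosure : Set E)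

open Filter Topology

section ClosedSpan

variable {E F : Type*} [NormedAddCommGroup E] [NormedSpace ℂ E]
  [NormedAddCommGroup F] [NormedSpace ℂ F]

lemma subset_clspan (S : Set E) : S ⊆ clspan S :=
  Submodule.subset_span.trans (Submodule.le_topologicalClosure _)

lemma isClosed_clspan (S : Set E) : IsClosed (clspan S) :=
  Submodule.isClosed_topologicalClosure _

lemma clspan_subset {S : Set E} {p : Submodule ℂ E} (hp : IsClosed (p : Set E))
    (h : S ⊆ p) : clspan S ⊆ p :=
  Submodule.topologicalClosure_minimal _ (Submodule.span_le.2 h) hp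

lemma map_mem_clspan (f : E →L[ℂ] F) {S : Set E} {T : Set F}
    (h : ∀ x ∈ S, f x ∈ clspan T) {x : E} (hx : x ∈ clspan S) : f x ∈ clspan T :=
  clspan_subset (p := (Submodule.span ℂ T).topologicalClosure.comap (f : E →ₗ[ℂ] F))
    ((isClosed_clspan T).preimage f.continuous) h hx

lemma clspan_mono {S T : Set E} (h : S ⊆ T) : clspan S ⊆ clspan T :=
  clspan_subset (isClosed_clspan T) (h.trans (subset_clspan T))

end ClosedSpan

section ApproximateUnit

variable {H K : Type*} [NormedAddCommGroup H] [NormedSpace ℂ H] [NormedAddCommGroup K]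

/-- The operators on which a filter of operators acts asymptotically as a left unit. -/
def leftUnitSubmodule [NormedSpace ℂ K] (l : Filter (K →L[ℂ] K)) :
    Submodule ℂ (H →L[ℂ] K) where
  carrier := {X | Tendsto (fun u : K →L[ℂ] K => u ∘L X) l (𝓝 X)}
  add_mem' {X Y} hX hY := by simpa using Tendsto.add hX hY
  zero_mem' := by simpa using tendsto_const_nhds
  smul_mem' c X hX := by simpa using Tendsto.const_smul hX c

lemma comp_mem_leftUnitSubmodule {G : Type*} [NormedAddCommGroup G] [NormedSpace ℂ G]
    [NormedSpace ℂ K] {l : Filter (K →L[ℂ] K)} {Y : G →L[ℂ] K}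
    (hY : Y ∈ leftUnitSubmodule l) (Z : H →L[ℂ] G) : Y ∘L Z ∈ leftUnitSubmodule l :=
  (((compL ℂ H G K).flip Z).continuous.tendsto Y).comp hY

lemma isClosed_leftUnitSubmodule [NormedSpace ℂ K]
    {l : Filter (K →L[ℂ] K)} (hl : ∀ᶠ u in l, ‖u‖ ≤ 1) :
    IsClosed ((leftUnitSubmodule l : Submodule ℂ (H →L[ℂ] K)) : Set (H →L[ℂ] K)) := by
  refine isClosed_of_closure_subset fun X hX => ?_
  change Tendsto (fun u : K →L[ℂ] K => u ∘L X) l (𝓝 X)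
  rw [Metric.tendsto_nhds]
  intro ε hε
  obtain ⟨Y, hY, hXY⟩ := Metric.mem_closure_iff.1 hX (ε / 3) (by positivity)
  filter_upwards [hl, Metric.tendsto_nhds.1 hY (ε / 3) (by positivity)] with u hu huY
  have huX : dist (u ∘L X) (u ∘L Y) ≤ dist X Y := by
    rw [dist_eq_norm, dist_eq_norm, ← comp_sub]
    exact (opNorm_comp_le _ _).trans (mul_le_of_le_one_left (norm_nonneg _) hu)
  have := dist_triangle4 (u ∘L X) (u ∘L Y) Y X
  rw [dist_comm Y X] at this
  linarith

lemma exists_approximateUnit_of_isClosed [InnerProductSpace ℂ K]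
    [CompleteSpace K] (C : NonUnitalStarSubalgebra ℂ (K →L[ℂ] K))
    (hC : IsClosed (C : Set (K →L[ℂ] K))) :
    ∃ l : Filter (K →L[ℂ] K), l.NeBot ∧ (∀ᶠ u in l, u ∈ C) ∧ (∀ᶠ u in l, ‖u‖ ≤ 1) ∧
      ∀ c ∈ C, Tendsto (fun u : K →L[ℂ] K => u ∘L c) l (𝓝 c) := by
  let : NonUnitalCStarAlgebra C := NonUnitalStarSubalgebra.nonUnitalCStarAlgebra C
  let : PartialOrder C := CStarAlgebra.spectralOrder C
  have : StarOrderedRing C := CStarAlgebra.spectralOrderedRing C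
  have hl := CStarAlgebra.increasingApproximateUnit C
  have := hl.neBot
  refine ⟨map Subtype.val (CStarAlgebra.approximateUnit C), inferInstance,
    eventually_map.2 (.of_forall fun u => u.2), eventually_map.2 hl.eventually_norm,
    fun c hc => tendsto_map'_iff.2 ?_⟩
  exact (continuous_subtype_val.tendsto _).comp (hl.tendsto_mul_right ⟨c, hc⟩)

end ApproximateUnit

section ConcreteModule

variable {H K : Type*} [NormedAddCommGroup H] [InnerProductSpace ℂ H] [CompleteSpace H]
  [NormedAddCommGroup K] [InnerProductSpace ℂ K] [CompleteSpace K]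
  {Γ : Set (H →L[ℂ] K)} {A : Set (H →L[ℂ] H)}

/-- The C*-algebra generated by `ΓΓ*`. -/
def leftAlgebra (Γ : Set (H →L[ℂ] K)) : NonUnitalStarSubalgebra ℂ (K →L[ℂ] K) :=
  (NonUnitalStarAlgebra.adjoin ℂ
    (Set.image2 (fun S T : H →L[ℂ] K => S ∘L adjoint T) Γ Γ)).topologicalClosure

lemma comp_adjoint_mem_leftAlgebra {S T : H →L[ℂ] K} (hS : S ∈ Γ) (hT : T ∈ Γ) :
    S ∘L adjoint T ∈ leftAlgebra Γ :=
  NonUnitalStarSubalgebra.le_topologicalClosure _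
    (NonUnitalStarAlgebra.subset_adjoin ℂ _ ⟨S, hS, T, hT, rfl⟩)

lemma leftAlgebra_comp_mem
    (hA : ∀ X ∈ clspan (Set.image2 (fun (γ : H →L[ℂ] K) (a : H →L[ℂ] H) => γ ∘L a) Γ A),
      ∀ γ ∈ Γ, adjoint γ ∘L X ∈ A)
    {c : K →L[ℂ] K} (hc : c ∈ leftAlgebra Γ) {X : H →L[ℂ] K}
    (hX : ∀ γ ∈ Γ, adjoint γ ∘L X ∈ A) :
    c ∘L X ∈ clspan (Set.image2 (fun (γ : H →L[ℂ] K) (a : H →L[ℂ] H) => γ ∘L a) Γ A) := by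
  set M : Submodule ℂ (H →L[ℂ] K) := (Submodule.span ℂ
    (Set.image2 (fun (γ : H →L[ℂ] K) (a : H →L[ℂ] H) => γ ∘L a) Γ A)).topologicalClosure
  change ∀ X ∈ M, _ at hA
  change c ∘L X ∈ M
  refine closure_minimal (s := (NonUnitalStarAlgebra.adjoin ℂ
    (Set.image2 (fun S T : H →L[ℂ] K => S ∘L adjoint T) Γ Γ) : Set (K →L[ℂ] K)))
    (t := {c : K →L[ℂ] K | c ∘L X ∈ M}) (fun c hc => ?_) ?_ hc
  · suffices ∀ X : H →L[ℂ] K, (∀ γ ∈ Γ, adjoint γ ∘L X ∈ A) → c ∘L X ∈ M from this X hX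
    induction hc using NonUnitalAlgebra.adjoin_induction with
    | mem c hc =>
      obtain ⟨S, hS, T, hT, rfl⟩ :
          ∃ S ∈ Γ, ∃ T ∈ Γ, S ∘L adjoint T = c := by
        rcases hc with hc | hc
        · exact hc
        · obtain ⟨S, hS, T, hT, h⟩ := hc
          refine ⟨T, hT, S, hS, ?_⟩
          rw [← star_star c, ← h, star_eq_adjoint, adjoint_comp, adjoint_adjoint]
      exact fun X hX => subset_clspan _ ⟨S, hS, _, hX T hT, rfl⟩
    | add x y _ _ hx hy =>
      exact fun X hX => by simpa only [add_comp] using M.add_mem (hx X hX) (hy X hX)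
    | zero => exact fun X _ => by simp
    | mul x y _ _ hx hy => exact fun X hX => hx _ (hA _ (hy X hX))
    | smul r x _ hx => exact fun X hX => by simpa only [smul_comp] using M.smul_mem r (hx X hX)
  · exact (Submodule.isClosed_topologicalClosure _).preimage
      ((compL ℂ H K K).flip X).continuous

/-- An operator `X` with `Γ*X ⊆ A` that factors through `Γ` lies in `[ΓA]`. -/
lemma mem_clspan_of_adjoint_comp_mem
    (hΓ : Γ ⊆ clspan (Set.image2 (fun (S : K →L[ℂ] K) (T : H →L[ℂ] K) => S ∘L T)
      (Set.image2 (fun (S T : H →L[ℂ] K) => S ∘L adjoint T) Γ Γ) Γ))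
    (hA : ∀ X ∈ clspan (Set.image2 (fun (γ : H →L[ℂ] K) (a : H →L[ℂ] H) => γ ∘L a) Γ A),
      ∀ γ ∈ Γ, adjoint γ ∘L X ∈ A)
    {X : H →L[ℂ] K}
    (hX : X ∈ clspan (Set.image2 (fun (γ : H →L[ℂ] K) (a : H →L[ℂ] H) => γ ∘L a) Γ Set.univ))
    (hXA : ∀ γ ∈ Γ, adjoint γ ∘L X ∈ A) :
    X ∈ clspan (Set.image2 (fun (γ : H →L[ℂ] K) (a : H →L[ℂ] H) => γ ∘L a) Γ A) := by
  obtain ⟨l, hl, hlC, hl1, hlu⟩ := exists_approximateUnit_of_isClosed (leftAlgebra Γ)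
    (NonUnitalStarSubalgebra.isClosed_topologicalClosure _)
  have hΓl : Γ ⊆ (leftUnitSubmodule l : Submodule ℂ (H →L[ℂ] K)) := by
    refine hΓ.trans (clspan_subset (isClosed_leftUnitSubmodule hl1) ?_)
    rintro _ ⟨_, ⟨S, hS, T, hT, rfl⟩, R, -, rfl⟩
    exact comp_mem_leftUnitSubmodule (hlu _ (comp_adjoint_mem_leftAlgebra hS hT)) R
  have hXl : X ∈ leftUnitSubmodule l := clspan_subset (isClosed_leftUnitSubmodule hl1)
    (by rintro _ ⟨γ, hγ, a, -, rfl⟩; exact comp_mem_leftUnitSubmodule (hΓl hγ) a) hX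
  exact (isClosed_clspan _).mem_of_tendsto hXl
    (hlC.mono fun u hu => leftAlgebra_comp_mem hA hu hXA)

end ConcreteModule

/-- With `Γ ⊆ L(H,K)` a concrete C*-module with `[ΓH]=K` and `A ⊆ L(H)` a
nondegenerate C*-algebra with `[A𝔅] ⊆ A` (`𝔅 = [Γ*Γ]`), one has
`Ind_Γ(A) = {T ∈ Ind_Γ(L(H)) : Γ*TΓ ⊆ A}`. -/
theorem stmt13
    {H K : Type*} [NormedAddCommGroup H] [InnerProductSpace ℂ H] [CompleteSpace H]
    [NormedAddCommGroup K] [InnerProductSpace ℂ K] [CompleteSpace K]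
    (Γ : Set (H →L[ℂ] K))
    (hΓclosed : clspan Γ = Γ)
    (hΓ : clspan (Set.image2 (fun (S : K →L[ℂ] K) (T : H →L[ℂ] K) => S ∘L T)
        (Set.image2 (fun (S T : H →L[ℂ] K) => S ∘L adjoint T) Γ Γ) Γ) = Γ)
    (hΓH : (Submodule.span ℂ {x : K | ∃ γ ∈ Γ, ∃ ζ : H, γ ζ = x}).topologicalClosure = ⊤)
    (A : Set (H →L[ℂ] H))
    (hAclosed : clspan A = A) (hAmul : ∀ a ∈ A, ∀ a' ∈ A, a ∘L a' ∈ A)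
    (hAstar : ∀ a ∈ A, adjoint a ∈ A)
    (hAnd : (Submodule.span ℂ {x : H | ∃ a ∈ A, ∃ ζ : H, a ζ = x}).topologicalClosure = ⊤)
    (hA𝔅 : clspan (Set.image2 (fun (a b : H →L[ℂ] H) => a ∘L b) A
        (clspan (Set.image2 (fun (S T : H →L[ℂ] K) => adjoint S ∘L T) Γ Γ))) ⊆ A) :
    {T : K →L[ℂ] K |
        (∀ γ ∈ Γ, T ∘L γ ∈
          clspan (Set.image2 (fun (γ' : H →L[ℂ] K) (a : H →L[ℂ] H) => γ' ∘L a) Γ A)) ∧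
        (∀ γ ∈ Γ, adjoint T ∘L γ ∈
          clspan (Set.image2 (fun (γ' : H →L[ℂ] K) (a : H →L[ℂ] H) => γ' ∘L a) Γ A))}
      =
    {T : K →L[ℂ] K |
        (∀ γ ∈ Γ, T ∘L γ ∈
          clspan (Set.image2 (fun (γ' : H →L[ℂ] K) (a : H →L[ℂ] H) => γ' ∘L a) Γ
            (Set.univ : Set (H →L[ℂ] H)))) ∧
        (∀ γ ∈ Γ, adjoint T ∘L γ ∈
          clspan (Set.image2 (fun (γ' : H →L[ℂ] K) (a : H →L[ℂ] H) => γ' ∘L a) Γ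
            (Set.univ : Set (H →L[ℂ] H)))) ∧
        (∀ γ ∈ Γ, ∀ γ' ∈ Γ, adjoint γ ∘L (T ∘L γ') ∈ A)} := by
  have hstar_comp {γ γ' : H →L[ℂ] K} (hγ : γ ∈ Γ) (hγ' : γ' ∈ Γ) {a : H →L[ℂ] H} (ha : a ∈ A) :
      adjoint γ ∘L (γ' ∘L a) ∈ A := by
    have h := hAstar _ (hA𝔅 (subset_clspan _
      ⟨_, hAstar a ha, _, subset_clspan _ ⟨γ', hγ', γ, hγ, rfl⟩, rfl⟩))
    simpa only [adjoint_comp, adjoint_adjoint, comp_assoc] using h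
  have hA : ∀ X ∈ clspan (Set.image2 (fun (γ : H →L[ℂ] K) (a : H →L[ℂ] H) => γ ∘L a) Γ A),
      ∀ γ ∈ Γ, adjoint γ ∘L X ∈ A := by
    intro X hX γ hγ
    rw [← hAclosed]
    refine map_mem_clspan (compL ℂ H K H (adjoint γ)) ?_ hX
    rintro _ ⟨γ', hγ', a, ha, rfl⟩
    exact subset_clspan A (hstar_comp hγ hγ' ha)
  have hmono := clspan_mono (Set.image2_subset_left (f := fun (γ : H →L[ℂ] K) (a : H →L[ℂ] H) =>
    γ ∘L a) (s := Γ) (Set.subset_univ A))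
  ext T
  constructor
  · rintro ⟨hT, hT'⟩
    exact ⟨fun γ hγ => hmono (hT γ hγ), fun γ hγ => hmono (hT' γ hγ),
      fun γ hγ γ' hγ' => hA _ (hT γ' hγ') γ hγ⟩
  · rintro ⟨hT, hT', hTA⟩
    refine ⟨fun γ hγ => mem_clspan_of_adjoint_comp_mem hΓ.ge hA (hT γ hγ)
        fun γ' hγ' => hTA γ' hγ' γ hγ,
      fun γ hγ => mem_clspan_of_adjoint_comp_mem hΓ.ge hA (hT' γ hγ) fun γ' hγ' => ?_⟩
    simpa only [adjoint_comp, adjoint_adjoint, comp_assoc] using hAstar _ (hTA γ hγ γ' hγ')
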